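/- (Lemma 4.6, lem:xi_v) Let ω := tH with t > 0, let v, v₁ ∈ M, set w := (0, H, (H,β)), d := ⟨v, w⟩/(H,H), d₁ := ⟨v₁, w⟩/(H,H), and assume d ≠ 0. Define ξ_v := e^β − ((ω,ω)/2)·ϱ − (⟨(1/d)·v, e^β − ((ω,ω)/2)·ϱ⟩/(H,H))·w ∈ M. Then ⟨v₁ − (d₁/d)·v, e^{β+√−1ω}⟩ = ⟨v₁, ξ_v⟩ (a real number); in particular ⟨v₁ − (d₁/d)·v, e^{β+√−1ω}⟩ = 0 if and only if ⟨v₁, ξ_v⟩ = 0. -/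

import Mathlib

noncomputable section

open scoped TensorProduct

/-- The Mukai pairing on the real Mukai lattice `ℝ × V × ℝ`. -/
def muk {V : Type*} [AddCommGroup V] [Module ℝ V]
    (B : V →ₗ[ℝ] V →ₗ[ℝ] ℝ) (x y : ℝ × V × ℝ) : ℝ :=
  B x.2.1 y.2.1 - x.1 * y.2.2 - x.2.2 * y.1

/-- `e^γ := (1, γ, (γ,γ)/2)`. -/
def expv {V : Type*} [AddCommGroup V] [Module ℝ V]
    (B : V →ₗ[ℝ] V →ₗ[ℝ] ℝ) (γ : V) : ℝ × V × ℝ :=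
  (1, γ, B γ γ / 2)

/-- `ϱ := (0,0,1)`. -/
def rhoV (V : Type*) [AddCommGroup V] [Module ℝ V] : ℝ × V × ℝ := (0, 0, 1)

/-- `ι_β(ξ) := (0, ξ, (ξ,β))`. -/
def iota {V : Type*} [AddCommGroup V] [Module ℝ V]
    (B : V →ₗ[ℝ] V →ₗ[ℝ] ℝ) (β ξ : V) : ℝ × V × ℝ :=
  (0, ξ, B ξ β)

/-- The complexification `V_ℂ := ℂ ⊗[ℝ] V` of `V`, and the natural map `V → V_ℂ`. -/
def toC {V : Type*} [AddCommGroup V] [Module ℝ V] (x : V) : ℂ ⊗[ℝ] V :=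
  (1 : ℂ) ⊗ₜ[ℝ] x

/-- The ℂ-bilinear extension of the Mukai pairing to `M_ℂ := ℂ × (ℂ ⊗[ℝ] V) × ℂ`. -/
def mukC {V : Type*} [AddCommGroup V] [Module ℝ V]
    (B : V →ₗ[ℝ] V →ₗ[ℝ] ℝ) (x y : ℂ × (ℂ ⊗[ℝ] V) × ℂ) : ℂ :=
  LinearMap.BilinForm.baseChange ℂ B x.2.1 y.2.1 - x.1 * y.2.2 - x.2.2 * y.1

/-- `e^z := (1, z, (z,z)/2)` for a complexified class `z ∈ V_ℂ`. -/
def expC {V : Type*} [AddCommGroup V] [Module ℝ V]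
    (B : V →ₗ[ℝ] V →ₗ[ℝ] ℝ) (z : ℂ ⊗[ℝ] V) : ℂ × (ℂ ⊗[ℝ] V) × ℂ :=
  (1, z, LinearMap.BilinForm.baseChange ℂ B z z / 2)

/-- The natural map `M → M_ℂ`. -/
def MtoC {V : Type*} [AddCommGroup V] [Module ℝ V] (x : ℝ × V × ℝ) :
    ℂ × (ℂ ⊗[ℝ] V) × ℂ :=
  ((x.1 : ℂ), toC x.2.1, (x.2.2 : ℂ))

section MukaiPairing

variable {V : Type*} [AddCommGroup V] [Module ℝ V] (B : V →ₗ[ℝ] V →ₗ[ℝ] ℝ)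

theorem muk_sub_smul_left (x y z : ℝ × V × ℝ) (c : ℝ) :
    muk B (x - c • y) z = muk B x z - c * muk B y z := by
  simp [muk]
  ring

theorem muk_smul_left (x z : ℝ × V × ℝ) (c : ℝ) :
    muk B (c • x) z = c * muk B x z := by
  simp [muk]
  ring

theorem muk_sub_smul_right (x y z : ℝ × V × ℝ) (c : ℝ) :
    muk B x (y - c • z) = muk B x y - c * muk B x z := by
  simp [muk]
  ring

theorem baseChange_toC (x y : V) :
    LinearMap.BilinForm.baseChange ℂ B (toC x) (toC y) = (B x y : ℂ) := by
  simp [toC]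

/-- The pairing of a real class with `e^{β+√-1ω}`, split into real and imaginary part. -/
theorem mukC_MtoC_expC (hB : ∀ x y, B x y = B y x) (x : ℝ × V × ℝ) (β ω : V) :
    mukC B (MtoC x) (expC B (toC β + Complex.I • toC ω)) =
      (muk B x (expv B β - (B ω ω / 2) • rhoV V) : ℂ) +
        Complex.I * (muk B x (iota B β ω) : ℂ) := by
  simp only [mukC, MtoC, expC, map_add, map_smul, LinearMap.add_apply, LinearMap.smul_apply,
    baseChange_toC, smul_eq_mul, muk, expv, rhoV, iota, Prod.fst_sub, Prod.snd_sub, Prod.smul_fst,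
    Prod.smul_snd, hB β ω, smul_zero, sub_zero, mul_one, mul_zero]
  push_cast
  linear_combination (-(x.1 : ℂ) * (B ω ω : ℂ) / 2) * Complex.I_sq

theorem iota_smul (β ξ : V) (c : ℝ) : iota B β (c • ξ) = c • iota B β ξ := by
  simp [iota]

theorem muk_smul_right (x z : ℝ × V × ℝ) (c : ℝ) :
    muk B x (c • z) = c * muk B x z := by
  simp [muk]
  ring

end MukaiPairing

/-- Lemma 4.6 (lem:xi_v). -/
theorem stmt15 {V : Type*} [AddCommGroup V] [Module ℝ V] [FiniteDimensional ℝ V]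
    (B : V →ₗ[ℝ] V →ₗ[ℝ] ℝ) (hB : ∀ x y, B x y = B y x)
    (H β : V) (hH : 0 < B H H)
    (t : ℝ) (ht : 0 < t) (ω : V) (hω : ω = t • H)
    (v v₁ : ℝ × V × ℝ)
    (w : ℝ × V × ℝ) (hw : w = (0, H, B H β))
    (d d₁ : ℝ) (hd : d = muk B v w / B H H) (hd₁ : d₁ = muk B v₁ w / B H H)
    (hd0 : d ≠ 0)
    (ξv : ℝ × V × ℝ)
    (hξv : ξv = expv B β - (B ω ω / 2) • rhoV V -
        (muk B (d⁻¹ • v) (expv B β - (B ω ω / 2) • rhoV V) / B H H) • w) :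
    mukC B (MtoC (v₁ - (d₁ / d) • v)) (expC B (toC β + Complex.I • toC ω)) =
      ((muk B v₁ ξv : ℝ) : ℂ) ∧
    (mukC B (MtoC (v₁ - (d₁ / d) • v)) (expC B (toC β + Complex.I • toC ω)) = 0 ↔
      muk B v₁ ξv = 0) := by
  have key : mukC B (MtoC (v₁ - (d₁ / d) • v)) (expC B (toC β + Complex.I • toC ω)) =
      ((muk B v₁ ξv : ℝ) : ℂ) := by
    have hw' : iota B β H = w := hw.symm
    have hv : muk B v w = d * B H H := by rw [hd, div_mul_cancel₀ _ hH.ne']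
    have hv₁ : muk B v₁ w = d₁ * B H H := by rw [hd₁, div_mul_cancel₀ _ hH.ne']
    have him : muk B (v₁ - (d₁ / d) • v) (iota B β ω) = 0 := by
      rw [hω, iota_smul, hw', muk_smul_right, muk_sub_smul_left, hv, hv₁]
      field_simp
      ring
    rw [mukC_MtoC_expC B hB, him, hξv, muk_sub_smul_right B v₁ _ w, muk_smul_left,
      muk_sub_smul_left, hv₁]
    simp only [Complex.ofReal_zero, mul_zero, add_zero]
    congr 1
    field_simp [hH.ne']
  exact ⟨key, by rw [key, Complex.ofReal_eq_zero]⟩
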